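/- Fix d, k ≥ 0 and let f : S_n → ℝ be a finite linear combination of indicators 1_{IJ} of partial permutations, each of size at most k. Then for any two partitions λ and λ′ of n with m_i(λ) = m_i(λ′) for all 1 ≤ i ≤ kd, one has E_λ[f^d] = E_{λ′}[f^d]. In particular, if m_i(λ) = 0 for all 1 ≤ i ≤ kd, then E_λ[f^d] = E_{(n)}[f^d], where (n) denotes the one-part partition of n (so K_{(n)} is the class of n-cycles). -/

import Mathlib

open Finset Filter
open scoped Classical BigOperators

namespace PaperStmt

/-- One step of the partial injection encoded by the tuples `I`, `J`. -/
noncomputable def pstep {k : ℕ} (I J : Fin k → ℕ) (x : ℕ) : Option ℕ :=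
  if h : ∃ ℓ, I ℓ = x then some (J h.choose) else none

/-- Iterates of the partial injection encoded by `I`, `J`. -/
noncomputable def piter {k : ℕ} (I J : Fin k → ℕ) : ℕ → ℕ → Option ℕ
  | 0, x => some x
  | t + 1, x => (piter I J t x).bind (pstep I J)

/-- The vertex set of the graph `G(I,J)`. -/
def pverts {k : ℕ} (I J : Fin k → ℕ) : Finset ℕ :=
  Finset.image I Finset.univ ∪ Finset.image J Finset.univ

/-- The number of directed cycles of length `i` in the graph `G(I,J)`. -/
noncomputable def cycleMult {k : ℕ} (I J : Fin k → ℕ) (i : ℕ) : ℕ :=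
  ((pverts I J).filter fun x =>
    piter I J i x = some x ∧ ∀ t, 0 < t → t < i → piter I J t x ≠ some x).card / i

/-- The number of directed path components with exactly `ℓ` edges in `G(I,J)`. -/
noncomputable def pathMult {k : ℕ} (I J : Fin k → ℕ) (ℓ : ℕ) : ℕ :=
  ((pverts I J).filter fun x =>
    (∀ a, J a ≠ x) ∧ (piter I J ℓ x).isSome ∧ piter I J (ℓ + 1) x = none).card

/-- The cycle partition `μ` of the partial permutation `(I,J)`. -/
noncomputable def cyclePart {k : ℕ} (I J : Fin k → ℕ) : Multiset ℕ :=
  ∑ i ∈ Finset.range (k + 1), Multiset.replicate (cycleMult I J i) i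

/-- The path partition `ν` of the partial permutation `(I,J)`. -/
noncomputable def pathPart {k : ℕ} (I J : Fin k → ℕ) : Multiset ℕ :=
  ∑ i ∈ Finset.range (k + 1), Multiset.replicate (pathMult I J i) i

/-- The full cycle type of a permutation (including fixed points as parts equal to 1). -/
noncomputable def fullCycleType {n : ℕ} (π : Equiv.Perm (Fin n)) : Multiset ℕ :=
  π.cycleType + Multiset.replicate (n - π.support.card) 1

/-- The conjugacy class `K_λ` of permutations of cycle type `λ`. -/
noncomputable def KClass {n : ℕ} (lam : Nat.Partition n) : Finset (Equiv.Perm (Fin n)) :=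
  Finset.univ.filter fun π => fullCycleType π = lam.parts

/-- Expectation of a statistic over the uniform distribution on `K_λ`. -/
noncomputable def expect {n : ℕ} (lam : Nat.Partition n) (f : Equiv.Perm (Fin n) → ℝ) : ℝ :=
  (∑ π ∈ KClass lam, f π) / (KClass lam).card

/-- The indicator `1_{IJ}` of the partial permutation `(I,J)` in `S_n`. -/
noncomputable def indic {n k : ℕ} (I J : Fin k → Fin n) (π : Equiv.Perm (Fin n)) : ℝ :=
  if ∀ ℓ, π (I ℓ) = J ℓ then 1 else 0


section LocalStatistics

open Equiv Function

section MinimalPeriod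

variable {α : Type*} [Fintype α]

theorem mem_periodicPts_perm (σ : Perm α) (x : α) : x ∈ periodicPts σ :=
  mk_mem_periodicPts (orderOf_pos σ) (by
    rw [IsPeriodicPt, IsFixedPt, Perm.iterate_eq_pow, pow_orderOf_eq_one, Perm.one_apply])

theorem one_le_minimalPeriod_perm (σ : Perm α) (x : α) : 1 ≤ minimalPeriod σ x :=
  minimalPeriod_pos_of_mem_periodicPts (mem_periodicPts_perm σ x)

theorem card_minimalPeriod_le (σ : Perm α) (m : ℕ) :
    Fintype.card {x // minimalPeriod σ x ≤ m} =
      ∑ i ∈ Finset.Icc 1 m, #{x | minimalPeriod σ x = i} := by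
  have hmaps : (({x | minimalPeriod σ x ≤ m} : Finset α) : Set α).MapsTo (minimalPeriod σ)
      (Finset.Icc 1 m : Finset ℕ) := fun x hx => by
    have hx' : minimalPeriod σ x ≤ m := by simpa using hx
    simpa using ⟨one_le_minimalPeriod_perm σ x, hx'⟩
  rw [Fintype.card_subtype, Finset.card_eq_sum_card_fiberwise hmaps]
  refine Finset.sum_congr rfl fun i hi => ?_
  rw [Finset.filter_filter]
  congr 1
  ext x
  simp only [Finset.mem_Icc] at hi
  simp only [Finset.mem_filter, Finset.mem_univ, true_and]
  omega

variable [DecidableEq α]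

theorem minimalPeriod_perm_eq_card_support_cycleOf (σ : Perm α) {x : α} (hx : σ x ≠ x) :
    minimalPeriod σ x = #(σ.cycleOf x).support := by
  have key : ∀ m, IsPeriodicPt σ m x ↔ #(σ.cycleOf x).support ∣ m := fun m => by
    rw [← (Perm.isCycleOn_support_cycleOf σ x).pow_apply_eq
      ((Perm.mem_support_cycleOf_iff' hx).2 (Perm.SameCycle.refl _ _)), IsPeriodicPt, IsFixedPt,
      Perm.iterate_eq_pow]
  exact Nat.dvd_antisymm ((key _).2 dvd_rfl).minimalPeriod_dvd
    ((key _).1 (isPeriodicPt_minimalPeriod _ _))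

theorem card_minimalPeriod_eq_mul_count_cycleType (σ : Perm α) {i : ℕ} (hi : 2 ≤ i) :
    #{x | minimalPeriod σ x = i} = i * σ.cycleType.count i := by
  have hne : ∀ x, minimalPeriod σ x = i → σ x ≠ x := fun x hx h => by
    rw [minimalPeriod_eq_one_iff_isFixedPt.2 h] at hx
    omega
  have hcount : σ.cycleType.count i = #{c ∈ σ.cycleFactorsFinset | #c.support = i} := by
    rw [Perm.cycleType_def, Multiset.count_map, Finset.card_def, Finset.filter_val]
    simp [eq_comm]
  have hmaps : (({x | minimalPeriod σ x = i} : Finset α) : Set α).MapsTo σ.cycleOf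
      (({c ∈ σ.cycleFactorsFinset | #c.support = i} : Finset (Perm α)) : Set (Perm α)) := by
    intro x hx
    have hx' : minimalPeriod σ x = i := by simpa using hx
    have hfix := hne x hx'
    simp only [Finset.mem_coe, Finset.mem_filter, Perm.cycleOf_mem_cycleFactorsFinset_iff,
      Perm.mem_support]
    exact ⟨hfix, by rw [← minimalPeriod_perm_eq_card_support_cycleOf σ hfix, hx']⟩
  rw [hcount, mul_comm, Finset.card_eq_sum_card_fiberwise hmaps]
  apply Finset.sum_const_nat
  intro c hc
  obtain ⟨hc, hci⟩ := Finset.mem_filter.1 hc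
  rw [← hci]
  congr 1
  ext x
  rw [← Perm.eq_cycleOf_of_mem_cycleFactorsFinset_iff σ c hc x]
  simp only [Finset.mem_filter, Finset.mem_univ, true_and]
  refine ⟨fun h => h.2.symm, fun h => ⟨?_, h.symm⟩⟩
  have hx := (Perm.eq_cycleOf_of_mem_cycleFactorsFinset_iff σ c hc x).1 h
  have hfix : σ x ≠ x :=
    Perm.mem_support.1 (Perm.mem_cycleFactorsFinset_support_le hc hx)
  rw [minimalPeriod_perm_eq_card_support_cycleOf σ hfix, ← h]

theorem card_minimalPeriod_eq_one (σ : Perm α) :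
    #{x | minimalPeriod σ x = 1} = Fintype.card α - #σ.support := by
  rw [← Finset.card_compl]
  congr 1
  ext x
  simp [minimalPeriod_eq_one_iff_isFixedPt, IsFixedPt]

theorem minimalPeriod_eq_of_semiconj {X Y : Type*} {f : X → X} {g : Y → Y} {j : X → Y}
    (hj : Injective j) (h : Semiconj j f g) (x : X) :
    minimalPeriod g (j x) = minimalPeriod f x := by
  rw [minimalPeriod_eq_minimalPeriod_iff]
  intro m
  rw [IsPeriodicPt, IsPeriodicPt, IsFixedPt, IsFixedPt, ← h.iterate_right m x, hj.eq_iff]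

theorem mul_count_cycleType_of_semiconj {β : Type*} [Fintype β] (σ : Perm β) (τ : Perm α)
    (j : α → β) (hj : Injective j) (h : Semiconj j τ σ) (m : ℕ)
    (hrange : ∀ x, x ∈ Set.range j ↔ minimalPeriod σ x ≤ m) {i : ℕ} (hi : 2 ≤ i) :
    i * τ.cycleType.count i = if i ≤ m then #{x | minimalPeriod σ x = i} else 0 := by
  rw [← card_minimalPeriod_eq_mul_count_cycleType τ hi]
  simp_rw [← minimalPeriod_eq_of_semiconj hj h]
  split_ifs with him
  · refine Finset.card_bij (fun y _ => j y) (by simp) (fun _ _ _ _ e => hj e) ?_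
    intro x hx
    have hx' : minimalPeriod σ x = i := by simpa using hx
    obtain ⟨y, rfl⟩ := (hrange x).2 (by omega)
    exact ⟨y, by simpa using hx', rfl⟩
  · rw [Finset.card_eq_zero, Finset.filter_eq_empty_iff]
    intro y _ hy
    have := (hrange (j y)).1 ⟨y, rfl⟩
    omega

/-- Two permutations with equally many points on cycles of each length at most `m` are conjugate
as far as these cycles are concerned. -/
theorem exists_perm_apply_comm_of_minimalPeriod_le (σ τ : Perm α) (m : ℕ)
    (h : ∀ i, 1 ≤ i → i ≤ m → #{x | minimalPeriod σ x = i} = #{x | minimalPeriod τ x = i}) :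
    ∃ ρ : Perm α, ∀ x, minimalPeriod σ x ≤ m → ρ (σ x) = τ (ρ x) := by
  have hcard : Fintype.card {x // minimalPeriod σ x ≤ m} =
      Fintype.card {x // minimalPeriod τ x ≤ m} := by
    rw [card_minimalPeriod_le, card_minimalPeriod_le]
    refine Finset.sum_congr rfl fun i hi => ?_
    rw [Finset.mem_Icc] at hi
    exact h i hi.1 hi.2
  let e := Fintype.equivOfCardEq hcard
  have hmem : ∀ (π : Perm α) (x : α), minimalPeriod π (π x) ≤ m ↔ minimalPeriod π x ≤ m :=
    fun π x => by rw [minimalPeriod_apply (mem_periodicPts_perm π x)]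
  let a : Perm {x // minimalPeriod σ x ≤ m} := σ.subtypePerm (hmem σ)
  let b : Perm {x // minimalPeriod σ x ≤ m} := e.symm.permCongr (τ.subtypePerm (hmem τ))
  have heb : ∀ y, (e (b y) : α) = τ (e y) := fun y => by simp [b, Equiv.permCongr_apply]
  have hab : a.cycleType = b.cycleType := by
    ext i
    by_cases hi : 2 ≤ i
    · have ha := mul_count_cycleType_of_semiconj σ a Subtype.val Subtype.val_injective
        (fun _ => rfl) m (fun x => by simp) hi
      have hb := mul_count_cycleType_of_semiconj τ b (fun y => (e y : α))
        (Subtype.val_injective.comp e.injective) heb m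
        (fun x => ⟨by rintro ⟨y, rfl⟩; exact (e y).2,
          fun hx => ⟨e.symm ⟨x, hx⟩, by simp⟩⟩) hi
      apply Nat.eq_of_mul_eq_mul_left (by omega : 0 < i)
      rw [ha, hb]
      split_ifs with him
      · exact h i (by omega) him
      · rfl
    · rw [Multiset.count_eq_zero_of_notMem fun h => hi (Perm.two_le_of_mem_cycleType h),
        Multiset.count_eq_zero_of_notMem fun h => hi (Perm.two_le_of_mem_cycleType h)]
  obtain ⟨c, hc⟩ := isConj_iff.1 (Perm.isConj_of_cycleType_eq hab)
  have hca : ∀ y, c (a y) = b (c y) := fun y => by rw [← hc]; simp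
  refine ⟨(c.trans e).extendSubtype, fun x hx => ?_⟩
  rw [Equiv.extendSubtype_apply_of_mem _ x hx,
    Equiv.extendSubtype_apply_of_mem _ (σ x) ((hmem σ x).2 hx)]
  have := heb (c ⟨x, hx⟩)
  rw [← hca] at this
  exact this

end MinimalPeriod

section Occurrences

theorem minimalPeriod_le_card_of_range_subset_domain {α : Type*} [DecidableEq α]
    (π : Perm α) (S : Finset (α × α)) (hS : ∀ p ∈ S, ∃ z, (p.2, z) ∈ S)
    (g : Perm α) (hg : ∀ p ∈ S, π (g p.1) = g p.2)
    {p : α × α} (hp : p ∈ S) : minimalPeriod π (g p.1) ≤ #S := by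
  have hiter : ∀ j, π^[j] (g p.1) ∈ S.image fun q => g q.1 := by
    intro j
    induction j with
    | zero => exact Finset.mem_image_of_mem (fun q : α × α => g q.1) hp
    | succ j ih =>
      obtain ⟨q, hq, hqj⟩ := Finset.mem_image.1 ih
      obtain ⟨z, hz⟩ := hS q hq
      rw [iterate_succ_apply', ← hqj, hg q hq]
      exact Finset.mem_image_of_mem (fun q : α × α => g q.1) hz
  calc minimalPeriod π (g p.1) = #(Finset.range (minimalPeriod π (g p.1))) := by simp
    _ ≤ #(S.image fun q => g q.1) :=
        Finset.card_le_card_of_injOn (fun j => π^[j] (g p.1)) (fun j _ => hiter j) (by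
          intro i hi j hj hij
          exact iterate_injOn_Iio_minimalPeriod (by simpa using hi) (by simpa using hj) hij)
    _ ≤ #S := Finset.card_image_le

variable {α : Type*} [Fintype α] [DecidableEq α]

/-- The number of relabellings `g` that carry every directed edge in `S` to an edge of the
functional graph of `π`. -/
def occurrences (π : Perm α) (S : Finset (α × α)) : ℕ :=
  #{g : Perm α | ∀ p ∈ S, π (g p.1) = g p.2}

/-- The endpoints of the edges in `S`. -/
def endpoints (S : Finset (α × α)) : Finset α :=
  S.image Prod.fst ∪ S.image Prod.snd

theorem occurrences_le_of_range_subset_domain (π π' : Perm α) (m : ℕ)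
    (h : ∀ i, 1 ≤ i → i ≤ m → #{x | minimalPeriod π x = i} = #{x | minimalPeriod π' x = i})
    (S : Finset (α × α)) (hm : #S ≤ m) (hS : ∀ p ∈ S, ∃ z, (p.2, z) ∈ S) :
    occurrences π S ≤ occurrences π' S := by
  obtain ⟨ρ, hρ⟩ := exists_perm_apply_comm_of_minimalPeriod_le π π' m h
  refine Finset.card_le_card_of_injOn (fun g => ρ * g) ?_ fun _ _ _ _ e => mul_left_cancel e
  intro g hg
  have hg' : ∀ p ∈ S, π (g p.1) = g p.2 := by
    simpa only [Finset.mem_coe, Finset.mem_filter, Finset.mem_univ, true_and] using hg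
  simp only [Finset.mem_coe, Finset.mem_filter, Finset.mem_univ, true_and, Perm.mul_apply]
  intro p hp
  rw [← hρ _ ((minimalPeriod_le_card_of_range_subset_domain π S hS g hg' hp).trans hm), hg' p hp]

theorem occurrences_eq_zero_of_not_injective (π : Perm α) (S : Finset (α × α)) {p q : α × α}
    (hp : p ∈ S) (hq : q ∈ S) (h2 : p.2 = q.2) (h1 : p.1 ≠ q.1) : occurrences π S = 0 := by
  rw [occurrences, Finset.card_eq_zero, Finset.filter_eq_empty_iff]
  intro g _ hg
  exact h1 (g.injective (π.injective (by rw [hg p hp, hg q hq, h2])))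

theorem occurrences_eq_sum_insert (π : Perm α) (S : Finset (α × α)) (x : α) :
    occurrences π S = ∑ z, occurrences π (insert (x, z) S) := by
  rw [occurrences, Finset.card_eq_sum_card_fiberwise (f := fun g : Perm α => g⁻¹ (π (g x)))
    (t := Finset.univ) (fun _ _ => Finset.mem_coe.2 (Finset.mem_univ _))]
  refine Finset.sum_congr rfl fun z _ => ?_
  rw [occurrences, Finset.filter_filter]
  congr 1
  ext g
  simp only [Finset.mem_filter, Finset.mem_univ, true_and, Finset.forall_mem_insert,
    Perm.inv_eq_iff_eq]
  tauto

theorem occurrences_insert_eq_of_notMem_endpoints (π : Perm α) (S : Finset (α × α)) {x y z : α}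
    (hy : y ∉ endpoints S) (hz : z ∉ endpoints S) (hyx : y ≠ x) (hzx : z ≠ x) :
    occurrences π (insert (x, z) S) = occurrences π (insert (x, y) S) := by
  refine Finset.card_equiv (Equiv.mulRight (swap y z)) fun g => ?_
  have hfix : ∀ p ∈ S, swap y z p.1 = p.1 ∧ swap y z p.2 = p.2 := by
    intro p hp
    have h1 : p.1 ∈ endpoints S := Finset.mem_union_left _ (Finset.mem_image_of_mem _ hp)
    have h2 : p.2 ∈ endpoints S := Finset.mem_union_right _ (Finset.mem_image_of_mem _ hp)
    exact ⟨swap_apply_of_ne_of_ne (by grind) (by grind),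
      swap_apply_of_ne_of_ne (by grind) (by grind)⟩
  simp only [Finset.mem_filter, Finset.mem_univ, true_and, Finset.forall_mem_insert,
    Equiv.coe_mulRight, Perm.mul_apply, swap_apply_left,
    swap_apply_of_ne_of_ne hyx.symm hzx.symm]
  refine and_congr_right fun _ => forall₂_congr fun p hp => ?_
  rw [(hfix p hp).1, (hfix p hp).2]

/-- The number of occurrences of a pattern with at most `m` edges only depends on the numbers of
points on cycles of length at most `m`. -/
theorem occurrences_eq_of_card_minimalPeriod_eq (π π' : Perm α) (m : ℕ)
    (h : ∀ i, 1 ≤ i → i ≤ m → #{x | minimalPeriod π x = i} = #{x | minimalPeriod π' x = i})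
    (S : Finset (α × α)) (hm : #S ≤ m) : occurrences π S = occurrences π' S := by
  induction hN : #S + #(endpoints S) using Nat.strong_induction_on generalizing S with
  | _ N ih =>
  subst hN
  by_cases hclosed : ∀ p ∈ S, ∃ z, (p.2, z) ∈ S
  · exact le_antisymm (occurrences_le_of_range_subset_domain π π' m h S hm hclosed)
      (occurrences_le_of_range_subset_domain π' π m (fun i hi him => (h i hi him).symm) S hm
        hclosed)
  by_cases hinj : ∀ p ∈ S, ∀ q ∈ S, p.2 = q.2 → p.1 = q.1
  swap
  · push Not at hinj
    obtain ⟨p, hp, q, hq, h2, h1⟩ := hinj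
    rw [occurrences_eq_zero_of_not_injective π S hp hq h2 h1,
      occurrences_eq_zero_of_not_injective π' S hp hq h2 h1]
  push Not at hclosed
  obtain ⟨⟨x, y⟩, hxy, hy⟩ := hclosed
  obtain ⟨T, hT, rfl⟩ : ∃ T, (x, y) ∉ T ∧ insert (x, y) T = S :=
    ⟨S.erase (x, y), Finset.notMem_erase _ _, Finset.insert_erase hxy⟩
  have hyx : y ≠ x := by
    rintro rfl
    exact hy y hxy
  have hyT : y ∉ endpoints T := by
    intro hyT
    rcases Finset.mem_union.1 hyT with hyT | hyT
    · obtain ⟨⟨a, b⟩, hp, rfl⟩ := Finset.mem_image.1 hyT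
      exact hy b (Finset.mem_insert_of_mem hp)
    · obtain ⟨⟨a, b⟩, hp, rfl⟩ := Finset.mem_image.1 hyT
      obtain rfl : a = x := hinj (a, b) (Finset.mem_insert_of_mem hp) (x, b) hxy rfl
      exact hT hp
  have hend : ∀ z, endpoints (insert (x, z) T) = insert x (insert z (endpoints T)) := by
    intro z
    ext w
    simp only [endpoints, Finset.image_insert, Finset.mem_union, Finset.mem_insert]
    tauto
  have hcardend : #(endpoints (insert (x, y) T)) = #(insert x (endpoints T)) + 1 := by
    rw [hend, Finset.insert_comm, Finset.card_insert_of_notMem]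
    simp [hyx, hyT]
  rw [Finset.card_insert_of_notMem hT] at hm ih
  have hTle : #(endpoints T) ≤ #(insert x (endpoints T)) :=
    Finset.card_le_card (Finset.subset_insert _ _)
  have hTeq : occurrences π T = occurrences π' T := ih _ (by omega) T (by omega) rfl
  have hrest : ∀ z, ¬(z ∉ endpoints T ∧ z ≠ x) →
      occurrences π (insert (x, z) T) = occurrences π' (insert (x, z) T) := by
    intro z hz
    have hcard := Finset.card_insert_le (x, z) T
    have hzend : endpoints (insert (x, z) T) = insert x (endpoints T) := by
      rw [hend]
      ext w
      simp only [Finset.mem_insert]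
      by_cases hwz : w = z
      · subst hwz
        tauto
      · tauto
    exact ih _ (by rw [hzend]; omega) _ (by omega) rfl
  have hsplit : ∀ ρ : Perm α, occurrences ρ T =
      #{z | z ∉ endpoints T ∧ z ≠ x} * occurrences ρ (insert (x, y) T) +
        ∑ z with ¬(z ∉ endpoints T ∧ z ≠ x), occurrences ρ (insert (x, z) T) := by
    intro ρ
    rw [occurrences_eq_sum_insert ρ T x,
      ← Finset.sum_filter_add_sum_filter_not Finset.univ (fun z => z ∉ endpoints T ∧ z ≠ x)]
    congr 1
    refine Finset.sum_const_nat fun z hz => ?_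
    obtain ⟨hz1, hz2⟩ := (Finset.mem_filter.1 hz).2
    exact occurrences_insert_eq_of_notMem_endpoints ρ T hyT hz1 hyx hz2
  rw [hsplit π, hsplit π', Finset.sum_congr rfl fun z hz => hrest z (Finset.mem_filter.1 hz).2]
    at hTeq
  refine Nat.eq_of_mul_eq_mul_left (Finset.card_pos.2 ⟨y, ?_⟩) (Nat.add_right_cancel hTeq)
  simp [hyT, hyx]

end Occurrences

section Expectation

variable {n : ℕ}

theorem count_fullCycleType (π : Perm (Fin n)) {i : ℕ} (hi : 1 ≤ i) :
    #{x | minimalPeriod π x = i} = i * (fullCycleType π).count i := by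
  rw [fullCycleType, Multiset.count_add, Multiset.count_replicate]
  obtain rfl | hi := hi.eq_or_lt
  · rw [card_minimalPeriod_eq_one, Fintype.card_fin, Multiset.count_eq_zero_of_notMem fun h =>
      (Perm.one_lt_of_mem_cycleType h).ne rfl]
    simp
  · rw [card_minimalPeriod_eq_mul_count_cycleType π hi, if_neg (by omega), add_zero]

theorem fullCycleType_eq_iff_isConj (π π' : Perm (Fin n)) :
    fullCycleType π = fullCycleType π' ↔ IsConj π π' := by
  rw [Perm.partition_eq_of_isConj, Nat.Partition.ext_iff, Perm.parts_partition,
    Perm.parts_partition, fullCycleType, fullCycleType, Fintype.card_fin]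

theorem exists_fullCycleType_eq (lam : Nat.Partition n) :
    ∃ π : Perm (Fin n), fullCycleType π = lam.parts := by
  have hsplit := Multiset.filter_add_not (fun a => 2 ≤ a) lam.parts
  have hones : lam.parts.filter (fun a => ¬2 ≤ a) =
      Multiset.replicate (lam.parts.filter (fun a => ¬2 ≤ a)).card 1 := by
    rw [Multiset.eq_replicate_card]
    intro a ha
    obtain ⟨ha, ha2⟩ := Multiset.mem_filter.1 ha
    have := lam.parts_pos ha
    omega
  have hsum : (lam.parts.filter (fun a => 2 ≤ a)).sum +
      (lam.parts.filter (fun a => ¬2 ≤ a)).card = n := by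
    conv_rhs => rw [← lam.parts_sum, ← hsplit, Multiset.sum_add, hones]
    simp
  obtain ⟨π, hπ⟩ := (Perm.exists_with_cycleType_iff (Fin n)
    (m := lam.parts.filter fun a => 2 ≤ a)).2
    ⟨by rw [Fintype.card_fin]; omega, fun a ha => (Multiset.mem_filter.1 ha).2⟩
  refine ⟨π, ?_⟩
  rw [fullCycleType, ← Perm.sum_cycleType, hπ, ← Nat.eq_sub_of_add_eq' hsum, ← hones, hsplit]

theorem mem_KClass {lam : Nat.Partition n} {π : Perm (Fin n)} :
    π ∈ KClass lam ↔ fullCycleType π = lam.parts := by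
  simp [KClass]

theorem conj_mem_KClass {lam : Nat.Partition n} {π : Perm (Fin n)} (g : Perm (Fin n))
    (h : π ∈ KClass lam) : g * π * g⁻¹ ∈ KClass lam := by
  rw [mem_KClass] at h ⊢
  rw [← h, fullCycleType_eq_iff_isConj]
  exact (isConj_iff.2 ⟨g, rfl⟩).symm

theorem expect_eq_sum_conj_div (lam : Nat.Partition n) {π₀ : Perm (Fin n)}
    (h₀ : π₀ ∈ KClass lam) (F : Perm (Fin n) → ℝ) :
    expect lam F = (∑ g, F (g * π₀ * g⁻¹)) / Fintype.card (Perm (Fin n)) := by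
  have hsum : ∀ π ∈ KClass lam, ∑ g, F (g * π * g⁻¹) = ∑ g, F (g * π₀ * g⁻¹) := by
    intro π hπ
    obtain ⟨c, hc⟩ := isConj_iff.1 ((fullCycleType_eq_iff_isConj π₀ π).1
      ((mem_KClass.1 h₀).trans (mem_KClass.1 hπ).symm))
    refine Fintype.sum_equiv (Equiv.mulRight c) _ _ fun g => ?_
    rw [← hc, Equiv.coe_mulRight, mul_inv_rev]
    simp only [mul_assoc]
  have hinv : ∀ g : Perm (Fin n), ∑ π ∈ KClass lam, F (g * π * g⁻¹) = ∑ π ∈ KClass lam, F π :=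
    fun g => Finset.sum_bij' (fun π _ => g * π * g⁻¹) (fun π _ => g⁻¹ * π * g)
      (fun π hπ => conj_mem_KClass g hπ)
      (fun π hπ => by simpa using conj_mem_KClass g⁻¹ hπ)
      (fun π _ => by group) (fun π _ => by group) (fun _ _ => rfl)
  have key : ∑ π ∈ KClass lam, ∑ g, F (g * π * g⁻¹) =
      ∑ g : Perm (Fin n), ∑ π ∈ KClass lam, F (g * π * g⁻¹) := Finset.sum_comm
  rw [Finset.sum_congr rfl hsum, Finset.sum_congr rfl fun g _ => hinv g, Finset.sum_const,
    Finset.sum_const, Finset.card_univ, nsmul_eq_mul, nsmul_eq_mul] at key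
  have hK : ((KClass lam).card : ℝ) ≠ 0 :=
    Nat.cast_ne_zero.2 (Finset.card_pos.2 ⟨π₀, h₀⟩).ne'
  have hG : (Fintype.card (Perm (Fin n)) : ℝ) ≠ 0 := Nat.cast_ne_zero.2 Fintype.card_ne_zero
  rw [expect, div_eq_div_iff hK hG]
  linarith

/-- The indicator of the permutations whose functional graph contains every edge in `S`. -/
def graphIndicator (S : Finset (Fin n × Fin n)) (π : Perm (Fin n)) : ℝ :=
  if ∀ p ∈ S, π p.1 = p.2 then 1 else 0

theorem expect_graphIndicator (lam : Nat.Partition n) {π₀ : Perm (Fin n)}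
    (h₀ : π₀ ∈ KClass lam) (S : Finset (Fin n × Fin n)) :
    expect lam (graphIndicator S) = occurrences π₀ S / Fintype.card (Perm (Fin n)) := by
  rw [expect_eq_sum_conj_div lam h₀]
  congr 1
  simp only [graphIndicator]
  rw [Finset.sum_boole]
  congr 1
  refine Finset.card_equiv (Equiv.inv _) fun g => ?_
  refine (Finset.mem_filter_univ _).trans (Iff.trans ?_ (Finset.mem_filter_univ _).symm)
  simp only [Perm.mul_apply, Equiv.inv_apply, Perm.eq_inv_iff_eq]

/-- The functions spanned by the graph indicators of at most `m` edges. -/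
def localStatistics (n m : ℕ) : Submodule ℝ (Perm (Fin n) → ℝ) :=
  Submodule.span ℝ {F | ∃ S : Finset (Fin n × Fin n), #S ≤ m ∧ graphIndicator S = F}

theorem graphIndicator_mul (S T : Finset (Fin n × Fin n)) :
    graphIndicator S * graphIndicator T = graphIndicator (S ∪ T) := by
  ext π
  rw [Pi.mul_apply, graphIndicator, graphIndicator, graphIndicator, ite_zero_mul_ite_zero, mul_one]
  exact if_congr Finset.forall_mem_union.symm rfl rfl

theorem mul_mem_localStatistics {k l : ℕ} {F G : Perm (Fin n) → ℝ}
    (hF : F ∈ localStatistics n k) (hG : G ∈ localStatistics n l) :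
    F * G ∈ localStatistics n (k + l) := by
  have h := Submodule.mul_mem_mul hF hG
  rw [localStatistics, localStatistics, Submodule.span_mul_span] at h
  refine Submodule.span_mono ?_ h
  rintro _ ⟨_, ⟨S, hS, rfl⟩, _, ⟨T, hT, rfl⟩, rfl⟩
  exact ⟨S ∪ T, (Finset.card_union_le _ _).trans (add_le_add hS hT), (graphIndicator_mul S T).symm⟩

theorem pow_mem_localStatistics {k : ℕ} {F : Perm (Fin n) → ℝ} (hF : F ∈ localStatistics n k)
    (d : ℕ) : F ^ d ∈ localStatistics n (k * d) := by
  induction d with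
  | zero =>
    refine Submodule.subset_span ⟨∅, by simp, ?_⟩
    ext π
    simp [graphIndicator]
  | succ d ih =>
    rw [pow_succ, Nat.mul_succ]
    exact mul_mem_localStatistics ih hF

theorem indic_mem_localStatistics {j k : ℕ} (hj : j ≤ k) (I J : Fin j → Fin n) :
    indic I J ∈ localStatistics n k := by
  refine Submodule.subset_span ⟨Finset.univ.image fun l => (I l, J l), ?_, ?_⟩
  · exact Finset.card_image_le.trans (by simpa using hj)
  · ext π
    simp [graphIndicator, indic]

theorem expect_add (lam : Nat.Partition n) (F G : Perm (Fin n) → ℝ) :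
    expect lam (F + G) = expect lam F + expect lam G := by
  simp [expect, Finset.sum_add_distrib, add_div]

theorem expect_smul (lam : Nat.Partition n) (c : ℝ) (F : Perm (Fin n) → ℝ) :
    expect lam (c • F) = c * expect lam F := by
  simp [expect, ← Finset.mul_sum, mul_div_assoc]

theorem expect_eq_of_mem_localStatistics {m : ℕ} {lam lam' : Nat.Partition n}
    (h : ∀ i, 1 ≤ i → i ≤ m → Multiset.count i lam.parts = Multiset.count i lam'.parts)
    {F : Perm (Fin n) → ℝ} (hF : F ∈ localStatistics n m) :
    expect lam F = expect lam' F := by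
  obtain ⟨π, hπ⟩ := exists_fullCycleType_eq lam
  obtain ⟨π', hπ'⟩ := exists_fullCycleType_eq lam'
  induction hF using Submodule.span_induction with
  | mem F hF =>
    obtain ⟨S, hS, rfl⟩ := hF
    rw [expect_graphIndicator lam (mem_KClass.2 hπ), expect_graphIndicator lam' (mem_KClass.2 hπ'),
      occurrences_eq_of_card_minimalPeriod_eq π π' m (fun i hi him => ?_) S hS]
    rw [count_fullCycleType π hi, count_fullCycleType π' hi, hπ, hπ', h i hi him]
  | zero => simp [expect]
  | add F G _ _ hF hG => rw [expect_add, expect_add, hF, hG]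
  | smul c F _ hF => rw [expect_smul, expect_smul, hF]

end Expectation

end LocalStatistics

/-- Proposition `local-statistic-long`.  Fix `d, k ≥ 0` and let
`f : S_n → ℝ` be a linear combination of indicators `1_{IJ}` of partial permutations of size
at most `k`.  If two partitions `λ, λ'` of `n` satisfy `m_i(λ) = m_i(λ')` for all
`1 ≤ i ≤ kd`, then `E_λ[f^d] = E_{λ'}[f^d]`.  In particular, if `m_i(λ) = 0` for all
`1 ≤ i ≤ kd`, then `E_λ[f^d] = E_{(n)}[f^d]`, where `(n)` is the one-part partition. -/
theorem statement18 {n : ℕ} (d k : ℕ) (f : Equiv.Perm (Fin n) → ℝ)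
    (hf : ∃ (N : ℕ) (kk : Fin N → ℕ) (c : Fin N → ℝ)
        (I : ∀ i, Fin (kk i) → Fin n) (J : ∀ i, Fin (kk i) → Fin n),
        (∀ i, kk i ≤ k) ∧ (∀ i, Function.Injective (I i)) ∧ (∀ i, Function.Injective (J i)) ∧
        ∀ π, f π = ∑ i, c i * indic (I i) (J i) π) :
    (∀ lam lam' : Nat.Partition n,
      (∀ i, 1 ≤ i → i ≤ k * d →
        Multiset.count i lam.parts = Multiset.count i lam'.parts) →
      expect lam (fun π => f π ^ d) = expect lam' (fun π => f π ^ d)) ∧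
    (∀ lam lam' : Nat.Partition n,
      (∀ i, 1 ≤ i → i ≤ k * d → Multiset.count i lam.parts = 0) →
      lam'.parts = {n} →
      expect lam (fun π => f π ^ d) = expect lam' (fun π => f π ^ d)) := by
  obtain ⟨N, kk, c, I, J, hkk, -, -, hfeq⟩ := hf
  have hmem : f ∈ localStatistics n k := by
    have : f = ∑ i, c i • indic (I i) (J i) := by
      ext π
      simp [hfeq π]
    rw [this]
    exact Submodule.sum_mem _ fun i _ =>
      Submodule.smul_mem _ _ (indic_mem_localStatistics (hkk i) (I i) (J i))
  have hpow := pow_mem_localStatistics hmem d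
  refine ⟨fun lam lam' h => expect_eq_of_mem_localStatistics h hpow, fun lam lam' h h' =>
    expect_eq_of_mem_localStatistics (fun i hi him => ?_) hpow⟩
  have hn : 0 < n := lam'.parts_pos (by simp [h'])
  rw [h i hi him, h', eq_comm, Multiset.count_eq_zero, Multiset.mem_singleton]
  rintro rfl
  obtain ⟨a, ha⟩ : ∃ a, a ∈ lam.parts := by
    apply Multiset.exists_mem_of_ne_zero
    intro h0
    have := lam.parts_sum
    rw [h0, Multiset.sum_zero] at this
    omega
  have hai : a ≤ i := lam.parts_sum ▸ Multiset.le_sum_of_mem ha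
  exact (Multiset.count_pos.2 ha).ne' (h a (lam.parts_pos ha) (hai.trans him))

end PaperStmt
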